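/- arXiv:2409.18207 — 3 statements merged into one kernel-verified Lean document; each statement's English description precedes it below -/
import Mathlib

section
/- For every commutative ring A there exist an integral domain D, with fraction field F, and a set X of subrings of F, each containing the canonical image of D in F, such that the prime spectrum of A with its Zariski topology is homeomorphic to X endowed with the subspace topology induced by the Zariski topology on the set of subrings of F. -/
/-- The Zariski topology on the set of subrings of a commutative ring `R`,
generated by the sets `{S | r ∈ S}` for `r ∈ R`. -/
instance zariskiTopology (R : Type*) [CommRing R] : TopologicalSpace (Subring R) :=
  TopologicalSpace.generateFrom {U : Set (Subring R) | ∃ r : R, U = {S : Subring R | r ∈ S}}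

open MvPolynomial in
/-- The multiplicative set generated by the variables `X a`, `a ∉ p`. -/
noncomputable def auxM (A : Type) [CommRing A] (p : PrimeSpectrum A) : Submonoid (MvPolynomial A ℚ) :=
  Submonoid.closure {f | ∃ a : A, a ∉ p.asIdeal ∧ f = X a}

/-- The localization of the polynomial ring at `auxM A p`, as a subring. -/
noncomputable def auxS (A : Type) [CommRing A] (p : PrimeSpectrum A) :
    Subring (FractionRing (MvPolynomial A ℚ)) where
  carrier := {x | ∃ s ∈ auxM A p, ∃ f : MvPolynomial A ℚ,
    x * algebraMap _ (FractionRing (MvPolynomial A ℚ)) s = algebraMap _ _ f}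
  mul_mem' := by
    rintro x y ⟨s, hs, f, hf⟩ ⟨t, ht, g, hg⟩
    refine ⟨s * t, mul_mem hs ht, f * g, ?_⟩
    rw [map_mul, map_mul, ← hf, ← hg]; ring
  one_mem' := ⟨1, one_mem _, 1, by simp⟩
  add_mem' := by
    rintro x y ⟨s, hs, f, hf⟩ ⟨t, ht, g, hg⟩
    refine ⟨s * t, mul_mem hs ht, f * t + g * s, ?_⟩
    rw [map_add, map_mul, map_mul, map_mul, ← hf, ← hg]; ring
  zero_mem' := ⟨1, one_mem _, 0, by simp⟩
  neg_mem' := by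
    rintro x ⟨s, hs, f, hf⟩
    exact ⟨s, hs, -f, by rw [map_neg, ← hf]; ring⟩

open Topology in
theorem auxM_nhds (A : Type) [CommRing A] (p : PrimeSpectrum A) (s : MvPolynomial A ℚ)
    (hs : s ∈ auxM A p) : ∀ᶠ q in 𝓝 p, s ∈ auxM A q := by
  unfold auxM at hs
  induction hs using Submonoid.closure_induction with
  | mem x hx =>
    obtain ⟨a, ha, rfl⟩ := hx
    have h : ∀ᶠ q in 𝓝 p, q ∈ PrimeSpectrum.basicOpen a :=
      (PrimeSpectrum.basicOpen a).isOpen.mem_nhds ha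
    exact h.mono fun q hq => Submonoid.subset_closure ⟨a, hq, rfl⟩
  | one => exact Filter.Eventually.of_forall fun q => one_mem _
  | mul x y _ _ hx hy =>
    filter_upwards [hx, hy] with q h1 h2 using mul_mem h1 h2

theorem auxS_isOpen (A : Type) [CommRing A] (x : FractionRing (MvPolynomial A ℚ)) :
    IsOpen {p : PrimeSpectrum A | x ∈ auxS A p} := by
  rw [isOpen_iff_eventually]
  rintro p ⟨s, hs, f, hf⟩
  exact (auxM_nhds A p s hs).mono fun q hq => ⟨s, hq, f, hf⟩

open MvPolynomial in
theorem auxS_inv (A : Type) [CommRing A] (a : A) (p : PrimeSpectrum A) :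
    (algebraMap (MvPolynomial A ℚ) (FractionRing (MvPolynomial A ℚ)) (X a))⁻¹ ∈ auxS A p
      ↔ a ∉ p.asIdeal := by
  classical
  have hX : algebraMap (MvPolynomial A ℚ) (FractionRing (MvPolynomial A ℚ)) (X a) ≠ 0 := by
    simp [X_ne_zero]
  constructor
  · rintro ⟨s, hs, f, hf⟩ ha
    have h1 : s = X a * f := by
      apply IsFractionRing.injective (MvPolynomial A ℚ) (FractionRing (MvPolynomial A ℚ))
      rw [map_mul, ← hf, mul_inv_cancel_left₀ hX]
    let φ : MvPolynomial A ℚ →+* ℚ := eval fun b => if b = a then 0 else 1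
    have h2 : φ s = 1 := by
      have : auxM A p ≤ Submonoid.comap φ.toMonoidHom ⊥ := by
        unfold auxM
        rw [Submonoid.closure_le]
        rintro _ ⟨b, hb, rfl⟩
        have : b ≠ a := fun h => hb (h ▸ ha)
        simp [φ, this]
      simpa using this hs
    rw [h1] at h2
    simp [φ] at h2
  · intro ha
    exact ⟨X a, Submonoid.subset_closure ⟨a, ha, rfl⟩, 1, by
      rw [map_one, inv_mul_cancel₀ hX]⟩

theorem auxS_isEmbedding (A : Type) [CommRing A] : Topology.IsEmbedding (auxS A) := by
  have hind : Topology.IsInducing (auxS A) := by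
    constructor
    apply le_antisymm
    · rw [← continuous_iff_le_induced]
      refine continuous_generateFrom_iff.2 ?_
      rintro _ ⟨r, rfl⟩
      exact auxS_isOpen A r
    · rw [(PrimeSpectrum.isTopologicalBasis_basic_opens (R := A)).eq_generateFrom]
      refine le_generateFrom ?_
      rintro _ ⟨a, rfl⟩
      refine ⟨_, TopologicalSpace.isOpen_generateFrom_of_mem
        ⟨(algebraMap (MvPolynomial A ℚ) (FractionRing (MvPolynomial A ℚ))
          (MvPolynomial.X a))⁻¹, rfl⟩, ?_⟩
      ext p
      exact auxS_inv A a p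
  exact hind.isEmbedding

/-- For every commutative ring `A` there exist an integral domain `D` with fraction
field `F` (realized as a subring `D` of the field `F` with `IsFractionRing D F`) and a
set `X` of subrings of `F`, each containing (the canonical image of) `D`, such that the
prime spectrum of `A` is homeomorphic to `X` with the subspace topology induced by the
Zariski topology on the set of subrings of `F`. -/
theorem primeSpectrum_homeomorph_space_of_subrings (A : Type) [CommRing A] :
    ∃ (F : Type) (_ : Field F) (D : Subring F) (X : Set (Subring F)),
      IsDomain D ∧ IsFractionRing D F ∧ (∀ S ∈ X, D ≤ S) ∧
      Nonempty (PrimeSpectrum A ≃ₜ X) := by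
  refine ⟨FractionRing (MvPolynomial A ℚ), inferInstance,
    (algebraMap (MvPolynomial A ℚ) (FractionRing (MvPolynomial A ℚ))).range,
    Set.range (auxS A), inferInstance, ?_, ?_, ⟨(auxS_isEmbedding A).toHomeomorph⟩⟩
  · have : FaithfulSMul (algebraMap (MvPolynomial A ℚ) (FractionRing (MvPolynomial A ℚ))).range
        (FractionRing (MvPolynomial A ℚ)) :=
      (faithfulSMul_iff_algebraMap_injective _ _).2 Subtype.val_injective
    apply IsFractionRing.of_field
    intro z
    obtain ⟨x, y, _, rfl⟩ := IsFractionRing.div_surjective (A := MvPolynomial A ℚ) z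
    exact ⟨⟨_, x, rfl⟩, ⟨_, y, rfl⟩, rfl⟩
  · rintro _ ⟨p, rfl⟩ _ ⟨f, rfl⟩
    exact ⟨1, one_mem _, f, by simp⟩
end

section
/- Let F be a field and let S be a local subring of F. Then the set X of all subrings T of F such that S ⊆ T, T is a local ring, and T dominates S (i.e., the maximal ideal of T contracts to the maximal ideal of S) is a closed subset of the set of subrings of F with respect to the patch topology. -/
/-- The patch topology on the set of subrings of a commutative ring `R`, generated by
the sets `{S | r ∈ S}` and `{S | r ∉ S}` for `r ∈ R`. -/
instance patchTopology (R : Type*) [CommRing R] : TopologicalSpace (Subring R) :=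
  TopologicalSpace.generateFrom
    ({U : Set (Subring R) | ∃ r : R, U = {S : Subring R | r ∈ S}} ∪
      {U : Set (Subring R) | ∃ r : R, U = {S : Subring R | r ∉ S}})

theorem patch_isClopen_mem {R : Type*} [CommRing R] (r : R) :
    IsClopen {S : Subring R | r ∈ S} := by
  constructor
  · rw [← isOpen_compl_iff]
    exact TopologicalSpace.isOpen_generateFrom_of_mem (Or.inr ⟨r, rfl⟩)
  · exact TopologicalSpace.isOpen_generateFrom_of_mem (Or.inl ⟨r, rfl⟩)

theorem subring_isUnit_iff {F : Type*} [Field F] (T : Subring F) (a : T) :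
    IsUnit a ↔ (a : F) ≠ 0 ∧ (a : F)⁻¹ ∈ T := by
  constructor
  · intro h
    obtain ⟨b, hb⟩ := isUnit_iff_exists_inv.1 h
    have hb' : (a : F) * b = 1 := by exact_mod_cast congrArg Subtype.val hb
    refine ⟨left_ne_zero_of_mul_eq_one hb', ?_⟩
    rw [inv_eq_of_mul_eq_one_right hb']
    exact b.2
  · rintro ⟨h0, h1⟩
    exact isUnit_iff_exists_inv.2 ⟨⟨_, h1⟩, Subtype.ext (mul_inv_cancel₀ h0)⟩

theorem dominating_set_eq (F : Type*) [Field F] (S : Subring F)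
    (hS : IsLocalRing S) :
    {T : Subring F | ∃ (hST : S ≤ T) (hT : IsLocalRing T),
      Ideal.comap (Subring.inclusion hST)
          (@IsLocalRing.maximalIdeal T _ hT) =
        @IsLocalRing.maximalIdeal S _ hS} =
    {T : Subring F | (∀ s ∈ S, s ∈ T) ∧
      (∀ x : F, x ∈ T → (x⁻¹ ∈ T ∨ (1 - x)⁻¹ ∈ T)) ∧
      (∀ s ∈ S, s⁻¹ ∈ T → s⁻¹ ∈ S)} := by
  ext T
  simp only [Set.mem_setOf_eq]
  constructor
  · rintro ⟨hST, hT, h⟩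
    refine ⟨fun s hs => hST hs, fun x hx => ?_, fun s hs hsT => ?_⟩
    · rcases IsLocalRing.isUnit_or_isUnit_one_sub_self (⟨x, hx⟩ : T) with h | h
      · exact Or.inl ((subring_isUnit_iff _ _).1 h).2
      · exact Or.inr ((subring_isUnit_iff _ _).1 h).2
    · by_cases h0 : s = 0
      · subst h0; simpa using hs
      · have h1 : IsUnit (⟨s, hST hs⟩ : T) := (subring_isUnit_iff _ _).2 ⟨h0, hsT⟩
        have h2 : (⟨s, hs⟩ : S) ∉ IsLocalRing.maximalIdeal S := by
          rw [← h, Ideal.mem_comap, IsLocalRing.mem_maximalIdeal, mem_nonunits_iff, not_not]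
          exact h1
        rw [IsLocalRing.mem_maximalIdeal, mem_nonunits_iff, not_not] at h2
        exact ((subring_isUnit_iff _ _).1 h2).2
  · rintro ⟨hST, h, h'⟩
    have hT : IsLocalRing T := by
      refine IsLocalRing.of_isUnit_or_isUnit_one_sub_self fun a => ?_
      by_cases h0 : (a : F) = 0
      · right
        have : a = 0 := Subtype.ext h0
        simp [this]
      by_cases h1 : 1 - (a : F) = 0
      · left
        have : a = 1 := Subtype.ext (sub_eq_zero.1 h1).symm
        simp [this]
      rcases h a a.2 with h | h
      · exact Or.inl ((subring_isUnit_iff _ _).2 ⟨h0, h⟩)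
      · exact Or.inr ((subring_isUnit_iff _ _).2 ⟨h1, h⟩)
    refine ⟨hST, hT, ?_⟩
    ext s
    rw [Ideal.mem_comap, IsLocalRing.mem_maximalIdeal, IsLocalRing.mem_maximalIdeal,
      mem_nonunits_iff, mem_nonunits_iff, not_iff_not]
    constructor
    · intro hu
      obtain ⟨h0, h1⟩ := (subring_isUnit_iff _ _).1 hu
      exact (subring_isUnit_iff _ _).2 ⟨h0, h' _ s.2 h1⟩
    · intro hu
      exact hu.map _

/-- Let `F` be a field and `S` a local subring of `F`.  The set of local subrings `T` of
`F` with `S ⊆ T` that dominate `S` (the maximal ideal of `T` contracts to the maximal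
ideal of `S`) is closed in the patch topology on the set of subrings of `F`. -/
theorem isClosed_dominating_local_subrings (F : Type*) [Field F] (S : Subring F)
    (hS : IsLocalRing S) :
    IsClosed {T : Subring F | ∃ (hST : S ≤ T) (hT : IsLocalRing T),
      Ideal.comap (Subring.inclusion hST)
          (@IsLocalRing.maximalIdeal T _ hT) =
        @IsLocalRing.maximalIdeal S _ hS} := by
  rw [dominating_set_eq]
  have hc : ∀ r : F, IsClosed {T : Subring F | r ∈ T} := fun r => (patch_isClopen_mem r).1
  have ho : ∀ r : F, IsOpen {T : Subring F | r ∈ T} := fun r => (patch_isClopen_mem r).2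
  simp only [Set.setOf_and, Set.setOf_forall]
  refine IsClosed.inter ?_ (IsClosed.inter ?_ ?_)
  · exact isClosed_iInter fun s => isClosed_iInter fun _ => hc s
  · exact isClosed_iInter fun x => isClosed_imp (ho x) ((hc _).union (hc _))
  · exact isClosed_iInter fun s => isClosed_iInter fun _ => isClosed_imp (ho _) isClosed_const
end

section
/- Let A be a commutative ring and let p be a prime ideal of A that is generated by idempotent elements, i.e., p equals the ideal of A generated by the set of idempotents contained in p. Then p is a minimal prime ideal of A: no prime ideal of A is properly contained in p. -/
/-- A prime ideal of a commutative ring that is generated by its idempotent elements is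
a minimal prime: no prime ideal is properly contained in it. -/
theorem minimal_of_prime_generated_by_idempotents (A : Type*) [CommRing A]
    (p : Ideal A) (hp : p.IsPrime)
    (hgen : p = Ideal.span {e : A | IsIdempotentElem e ∧ e ∈ p}) :
    ∀ q : Ideal A, q.IsPrime → ¬ q < p := by
  intro q hq hlt
  apply hlt.not_ge
  rw [hgen, Ideal.span_le]
  rintro e ⟨he, hep⟩
  have h0 : e * (1 - e) ∈ q := by
    have h1 : e * (1 - e) = 0 := by
      rw [mul_sub, mul_one, he.eq, sub_self]
    rw [h1]
    exact q.zero_mem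
  rcases hq.mem_or_mem h0 with h | h
  · exact h
  · exfalso
    apply hp.ne_top
    rw [Ideal.eq_top_iff_one]
    have h2 := p.add_mem hep (hlt.le h)
    rwa [add_sub_cancel] at h2
end
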